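/- arXiv:math/0302276 — 2 statements merged into one kernel-verified Lean document; each statement's English description precedes it below -/
import Mathlib

section
/- Let F be a field that is an algebra over ℝ. For every positive integer n, the distance √n belongs to D₂(F). -/
/-- `φ₂((x₁,x₂),(y₁,y₂)) = (x₁−y₁)² + (x₂−y₂)²` on `F²`. -/
def phi2 (F : Type*) [Field F] (x y : Fin 2 → F) : F := (x 0 - y 0) ^ 2 + (x 1 - y 1) ^ 2

/-- `D₂(F)`: the set of all real `d > 0` such that for all `x, y ∈ ℝ²` with
`|x−y| = d` there is a finite set `S` with `{x,y} ⊆ S ⊆ ℝ²` such that every map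
`f : S → F²` preserving unit distance satisfies `φ₂(f(x),f(y)) = d²`. -/
def D2 (F : Type*) [Field F] [Algebra ℝ F] : Set ℝ :=
  {d | 0 < d ∧ ∀ x y : EuclideanSpace ℝ (Fin 2), dist x y = d →
    ∃ S : Set (EuclideanSpace ℝ (Fin 2)), S.Finite ∧ x ∈ S ∧ y ∈ S ∧
      ∀ f : EuclideanSpace ℝ (Fin 2) → (Fin 2 → F),
        (∀ u ∈ S, ∀ v ∈ S, dist u v = 1 → phi2 F (f u) (f v) = 1) →
        phi2 F (f x) (f y) = algebraMap ℝ F (d ^ 2)}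

/-- The filter of properties of maps `ℝ² → F²` that are forced by preservation of unit distance
on some finite set of points. -/
def unitDistFilter (F : Type*) [Field F] : Filter (EuclideanSpace ℝ (Fin 2) → (Fin 2 → F)) where
  sets := {P | ∃ S : Set (EuclideanSpace ℝ (Fin 2)), S.Finite ∧
    ∀ f : EuclideanSpace ℝ (Fin 2) → (Fin 2 → F),
      (∀ u ∈ S, ∀ v ∈ S, dist u v = 1 → phi2 F (f u) (f v) = 1) → f ∈ P}
  univ_sets := ⟨∅, Set.finite_empty, fun _ _ => trivial⟩
  sets_of_superset := fun ⟨S, hS, h⟩ hPQ => ⟨S, hS, fun f hf => hPQ (h f hf)⟩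
  inter_sets := fun ⟨S, hS, h⟩ ⟨T, hT, k⟩ => ⟨S ∪ T, hS.union hT, fun f hf =>
    ⟨h f fun u hu v hv => hf u (Or.inl hu) v (Or.inl hv),
      k f fun u hu v hv => hf u (Or.inr hu) v (Or.inr hv)⟩⟩

theorem mem_D2_iff {F : Type*} [Field F] [Algebra ℝ F] {d : ℝ} :
    d ∈ D2 F ↔ 0 < d ∧ ∀ x y : EuclideanSpace ℝ (Fin 2), dist x y = d →
      ∀ᶠ f in unitDistFilter F, phi2 F (f x) (f y) = algebraMap ℝ F (d ^ 2) := by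
  refine and_congr_right fun _ => forall_congr' fun x => forall_congr' fun y =>
    imp_congr_right fun _ => ⟨?_, ?_⟩
  · rintro ⟨S, hS, -, -, h⟩
    exact ⟨S, hS, h⟩
  · rintro ⟨S, hS, h⟩
    exact ⟨insert x (insert y S), (hS.insert y).insert x, by simp, by simp, fun f hf =>
      h f fun u hu v hv => hf u (by simp [hu]) v (by simp [hv])⟩

theorem eventually_phi2_of_sqrt_mem_D2 {F : Type*} [Field F] [Algebra ℝ F] {A : ℝ}
    (hA : √A ∈ D2 F) {x y : EuclideanSpace ℝ (Fin 2)} (h : dist x y = √A) :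
    ∀ᶠ f in unitDistFilter F, phi2 F (f x) (f y) = algebraMap ℝ F A := by
  have h' := (mem_D2_iff.1 hA).2 x y h
  rwa [Real.sq_sqrt (Real.sqrt_pos.1 hA.1).le] at h'

theorem one_mem_D2 (F : Type*) [Field F] [Algebra ℝ F] : (1 : ℝ) ∈ D2 F :=
  ⟨one_pos, fun x y h => ⟨{x, y}, by simp, by simp, by simp, fun f hf => by
    simpa using hf x (by simp) y (by simp) h⟩⟩

/-- The point with coordinates `(a, b)` in the frame with origin `x` and first basis vector
`y - x`, the second one being its rotation by a right angle. -/
def framePoint (x y : EuclideanSpace ℝ (Fin 2)) (a b : ℝ) : EuclideanSpace ℝ (Fin 2) :=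
  !₂[x 0 + a * (y 0 - x 0) - b * (y 1 - x 1), x 1 + a * (y 1 - x 1) + b * (y 0 - x 0)]

theorem framePoint_zero_zero (x y : EuclideanSpace ℝ (Fin 2)) : framePoint x y 0 0 = x := by
  ext i; fin_cases i <;> simp [framePoint]

theorem framePoint_one_zero (x y : EuclideanSpace ℝ (Fin 2)) : framePoint x y 1 0 = y := by
  ext i; fin_cases i <;> simp [framePoint]

theorem dist_framePoint (x y : EuclideanSpace ℝ (Fin 2)) (a b a' b' : ℝ) :
    dist (framePoint x y a b) (framePoint x y a' b') =
      √((a - a') ^ 2 + (b - b') ^ 2) * dist x y := by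
  rw [EuclideanSpace.dist_eq, EuclideanSpace.dist_eq, ← Real.sqrt_mul (by positivity)]
  simp only [framePoint, Fin.sum_univ_two, Real.dist_eq, sq_abs]
  congr 1
  simp
  ring

theorem dist_framePoint_left (x y : EuclideanSpace ℝ (Fin 2)) (a b : ℝ) :
    dist x (framePoint x y a b) = √(a ^ 2 + b ^ 2) * dist x y := by
  simpa [framePoint_zero_zero] using dist_framePoint x y 0 0 a b

theorem dist_framePoint_right (x y : EuclideanSpace ℝ (Fin 2)) (a b : ℝ) :
    dist y (framePoint x y a b) = √((1 - a) ^ 2 + b ^ 2) * dist x y := by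
  simpa [framePoint_one_zero] using dist_framePoint x y 1 0 a b

theorem phi2_comm {F : Type*} [Field F] (x y : Fin 2 → F) : phi2 F x y = phi2 F y x := by
  simp only [phi2]; ring

/-- Two points with the same `phi2`-distances to `p` and to `q` either coincide or are mirror images
in the line through `p` and `q`. -/
theorem eq_or_mirror {F : Type*} [Field F] {p q x y : Fin 2 → F} {A B C : F} [CharZero F]
    (hC : C ≠ 0) (hpq : phi2 F p q = C) (hxp : phi2 F x p = A) (hyp : phi2 F y p = A)
    (hxq : phi2 F x q = B) (hyq : phi2 F y q = B) :
    x = y ∨ ∀ i, C * (x i + y i - 2 * p i) = (A + C - B) * (q i - p i) := by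
  simp only [phi2] at *
  have horth : (x 0 - y 0) * (q 0 - p 0) + (x 1 - y 1) * (q 1 - p 1) = 0 := by
    have : 2 * ((x 0 - y 0) * (q 0 - p 0) + (x 1 - y 1) * (q 1 - p 1)) = 0 := by
      linear_combination hxp - hyp - hxq + hyq
    simpa using this
  set s := (x 1 - y 1) * (q 0 - p 0) - (x 0 - y 0) * (q 1 - p 1) with hs
  set r := (x 1 + y 1 - 2 * p 1) * (q 0 - p 0) - (x 0 + y 0 - 2 * p 0) * (q 1 - p 1) with hr
  have h0 : C * (x 0 - y 0) = - s * (q 1 - p 1) := by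
    rw [← hpq, hs]; linear_combination (q 0 - p 0) * horth
  have h1 : C * (x 1 - y 1) = s * (q 0 - p 0) := by
    rw [← hpq, hs]; linear_combination (q 1 - p 1) * horth
  have hsr : s * r = 0 := by
    rw [hr]
    linear_combination C * (hxp - hyp) - (x 0 + y 0 - 2 * p 0) * h0 - (x 1 + y 1 - 2 * p 1) * h1
  rcases mul_eq_zero.1 hsr with h | h
  · left
    rw [h] at h0 h1
    ext i
    fin_cases i
    · simpa [hC, sub_eq_zero] using h0
    · simpa [hC, sub_eq_zero] using h1
  · right
    have hdot : (x 0 + y 0 - 2 * p 0) * (q 0 - p 0) + (x 1 + y 1 - 2 * p 1) * (q 1 - p 1)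
        = A + C - B := by
      have : 2 * ((x 0 + y 0 - 2 * p 0) * (q 0 - p 0) + (x 1 + y 1 - 2 * p 1) * (q 1 - p 1))
        = 2 * (A + C - B) := by
        linear_combination hxp + hyp - hxq - hyq + 2 * hpq
      exact mul_left_cancel₀ two_ne_zero this
    intro i
    fin_cases i
    · change C * (x 0 + y 0 - 2 * p 0) = (A + C - B) * (q 0 - p 0)
      rw [← hdot, ← hpq]; linear_combination (-(q 1 - p 1)) * h
    · change C * (x 1 + y 1 - 2 * p 1) = (A + C - B) * (q 1 - p 1)
      rw [← hdot, ← hpq]; linear_combination (q 0 - p 0) * h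

theorem eq_or_phi2_of_mirror {F : Type*} [Field F] [CharZero F] {p q x y : Fin 2 → F} {A B C D : F}
    (hC : C ≠ 0) (hpq : phi2 F p q = C) (hxp : phi2 F x p = A) (hyp : phi2 F y p = A)
    (hxq : phi2 F x q = B) (hyq : phi2 F y q = B) (hD : D * C + (A + C - B) ^ 2 = 4 * A * C) :
    x = y ∨ phi2 F x y = D := by
  refine (eq_or_mirror hC hpq hxp hyp hxq hyq).imp_right fun h => ?_
  have h0 := h 0
  have h1 := h 1
  have : C ^ 2 * phi2 F x y = C ^ 2 * D := by
    simp only [phi2] at *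
    linear_combination 2 * C ^ 2 * (hxp + hyp) - C * hD - (A + C - B) ^ 2 * hpq
      - (C * (x 0 + y 0 - 2 * p 0) + (A + C - B) * (q 0 - p 0)) * h0
      - (C * (x 1 + y 1 - 2 * p 1) + (A + C - B) * (q 1 - p 1)) * h1
  exact mul_left_cancel₀ (pow_ne_zero 2 hC) this

theorem eventually_eq_or_phi2 {F : Type*} [Field F] [Algebra ℝ F] {A B C D : ℝ}
    (hA : √A ∈ D2 F) (hB : √B ∈ D2 F) (hC : √C ∈ D2 F) (hD : 0 < D)
    (h : D * C + (A + C - B) ^ 2 = 4 * A * C)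
    {x y : EuclideanSpace ℝ (Fin 2)} (hxy : dist x y = √D) :
    ∀ᶠ f in unitDistFilter F, f x = f y ∨ phi2 F (f x) (f y) = algebraMap ℝ F D := by
  have : CharZero F := charZero_of_injective_algebraMap (algebraMap ℝ F).injective
  have hC0 : 0 < C := Real.sqrt_pos.1 hC.1
  set s : ℝ := (A + C - B) / (2 * √C * √D) with hs
  set t : ℝ := √C / √D with ht
  have hs2 : (1 / 2) ^ 2 + s ^ 2 = A / D := by
    rw [hs, div_pow _ (2 * √C * √D), mul_pow, mul_pow, Real.sq_sqrt hC0.le, Real.sq_sqrt hD.le]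
    field_simp
    linear_combination h
  have ht2 : t ^ 2 = C / D := by
    rw [ht, div_pow, Real.sq_sqrt hC0.le, Real.sq_sqrt hD.le]
  have hst : 2 * s * t = (A + C - B) / D := by
    rw [hs, ht, ← Real.sq_sqrt hD.le, Real.sqrt_sq (Real.sqrt_nonneg D)]
    field_simp
  have hst2 : (1 / 2) ^ 2 + (t - s) ^ 2 = B / D := by
    linear_combination hs2 + ht2 - hst
  have key (E : ℝ) : √(E / D) * √D = √E := by
    rw [← Real.sqrt_mul' _ hD.le, div_mul_cancel₀ _ hD.ne']
  set p := framePoint x y (1 / 2) (-s)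
  set q := framePoint x y (1 / 2) (t - s)
  have hxp : dist x p = √A := by
    rw [dist_framePoint_left, neg_sq, hs2, hxy, key]
  have hyp : dist y p = √A := by
    rw [dist_framePoint_right, neg_sq, show (1 - 1 / 2 : ℝ) = 1 / 2 by norm_num, hs2, hxy, key]
  have hxq : dist x q = √B := by
    rw [dist_framePoint_left, hst2, hxy, key]
  have hyq : dist y q = √B := by
    rw [dist_framePoint_right, show (1 - 1 / 2 : ℝ) = 1 / 2 by norm_num, hst2, hxy, key]
  have hpq : dist p q = √C := by
    rw [dist_framePoint, hxy, ← key C, ← ht2]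
    ring_nf
  filter_upwards [eventually_phi2_of_sqrt_mem_D2 hA hxp, eventually_phi2_of_sqrt_mem_D2 hA hyp,
    eventually_phi2_of_sqrt_mem_D2 hB hxq, eventually_phi2_of_sqrt_mem_D2 hB hyq,
    eventually_phi2_of_sqrt_mem_D2 hC hpq] with f h1 h2 h3 h4 h5
  refine eq_or_phi2_of_mirror ?_ h5 h1 h2 h3 h4 ?_
  · simpa using hC0.ne'
  · simpa [map_ofNat (algebraMap ℝ F)] using congrArg (algebraMap ℝ F) h

/-- If the sides of a triangle have lengths `√A`, `√B`, `√C`, all in `D₂(F)`, then twice the altitude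
on the third side is in `D₂(F)`, provided that it is larger than `1`. -/
theorem sqrt_mem_D2_of_mirror {F : Type*} [Field F] [Algebra ℝ F] {A B C D : ℝ}
    (hA : √A ∈ D2 F) (hB : √B ∈ D2 F) (hC : √C ∈ D2 F) (hD : 1 < D)
    (h : D * C + (A + C - B) ^ 2 = 4 * A * C) : √D ∈ D2 F := by
  have hD0 : 0 < D := one_pos.trans hD
  refine mem_D2_iff.2 ⟨Real.sqrt_pos.2 hD0, fun x y hxy => ?_⟩
  set a : ℝ := 1 - 1 / (2 * D) with ha
  have hinv : 1 / (2 * D) < 1 := by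
    rw [div_lt_one (by positivity)]; linarith
  have hinv0 : 0 < 1 / (2 * D) := by positivity
  have hb : √(1 - a ^ 2) ^ 2 = 1 - a ^ 2 := Real.sq_sqrt (by rw [ha]; nlinarith)
  set z := framePoint x y a √(1 - a ^ 2)
  have hxz : dist x z = √D := by
    rw [dist_framePoint_left, hb, hxy]; simp
  have hyz : dist y z = √1 := by
    rw [dist_framePoint_right, hb, hxy, ← Real.sqrt_mul' _ hD0.le]
    congr 1
    rw [ha]; field_simp; ring
  have h1 : √(1 : ℝ) ∈ D2 F := by simpa using one_mem_D2 F
  filter_upwards [eventually_eq_or_phi2 hA hB hC hD0 h hxy, eventually_eq_or_phi2 hA hB hC hD0 h hxz,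
    eventually_phi2_of_sqrt_mem_D2 h1 hyz] with f hy hz hyz'
  rw [Real.sq_sqrt hD0.le]
  rcases hy with hy | hy
  · rw [← hy] at hyz'
    rcases hz with hz | hz
    · rw [← hz] at hyz'
      simp [phi2] at hyz'
    · exact absurd ((algebraMap ℝ F).injective (hyz'.symm.trans hz)) hD.ne
  · exact hy

theorem sqrt_three_mem_D2 (F : Type*) [Field F] [Algebra ℝ F] : √3 ∈ D2 F := by
  have h1 : √(1 : ℝ) ∈ D2 F := by simpa using one_mem_D2 F
  exact sqrt_mem_D2_of_mirror h1 h1 h1 (by norm_num) (by norm_num)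

theorem sqrt_four_mem_D2 (F : Type*) [Field F] [Algebra ℝ F] : √4 ∈ D2 F := by
  have : CharZero F := charZero_of_injective_algebraMap (algebraMap ℝ F).injective
  refine mem_D2_iff.2 ⟨by positivity, fun x y hxy => ?_⟩
  have h1 : √(1 : ℝ) ∈ D2 F := by simpa using one_mem_D2 F
  have h3 := sqrt_three_mem_D2 F
  have key (E : ℝ) : √(E / 4) * √4 = √E := by
    rw [← Real.sqrt_mul' _ (by norm_num), div_mul_cancel₀ _ (by norm_num)]
  have hs : (√3 / 4) ^ 2 = (3 / 16 : ℝ) := by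
    rw [div_pow, Real.sq_sqrt (by norm_num)]; norm_num
  set m := framePoint x y (1 / 2) 0
  set p := framePoint x y (1 / 4) (√3 / 4)
  set q := framePoint x y (3 / 4) (√3 / 4)
  have hxm : dist x m = √1 := by
    rw [dist_framePoint_left, hxy, ← key 1]; norm_num
  have hxp : dist x p = √1 := by
    rw [dist_framePoint_left, hs, hxy, ← key 1]; norm_num
  have hxq : dist x q = √3 := by
    rw [dist_framePoint_left, hs, hxy, ← key 3]; norm_num
  have hyp : dist y p = √3 := by
    rw [dist_framePoint_right, hs, hxy, ← key 3]; norm_num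
  have hyq : dist y q = √1 := by
    rw [dist_framePoint_right, hs, hxy, ← key 1]; norm_num
  have hym : dist y m = √1 := by
    rw [dist_framePoint_right, hxy, ← key 1]; norm_num
  have hpm : dist p m = √1 := by
    rw [dist_framePoint, sub_zero, hs, hxy, ← key 1]; norm_num
  have hqm : dist q m = √1 := by
    rw [dist_framePoint, sub_zero, hs, hxy, ← key 1]; norm_num
  have hpq : dist p q = √1 := by
    rw [dist_framePoint, hxy, ← key 1, sub_self]; norm_num
  filter_upwards [eventually_phi2_of_sqrt_mem_D2 h1 hxm, eventually_phi2_of_sqrt_mem_D2 h1 hxp,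
    eventually_phi2_of_sqrt_mem_D2 h3 hxq, eventually_phi2_of_sqrt_mem_D2 h3 hyp,
    eventually_phi2_of_sqrt_mem_D2 h1 hyq, eventually_phi2_of_sqrt_mem_D2 h1 hym,
    eventually_phi2_of_sqrt_mem_D2 h1 hpm, eventually_phi2_of_sqrt_mem_D2 h1 hqm,
    eventually_phi2_of_sqrt_mem_D2 h1 hpq] with f xm xp xq yp yq ym pm qm pq
  rw [map_one] at xm xp yq ym pm qm pq
  rw [map_ofNat] at xq yp
  have hxq' : f x ≠ f q := fun h => by
    rw [h] at xq
    simp [phi2] at xq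
  have hyp' : f y ≠ f p := fun h => by
    rw [h] at yp
    simp [phi2] at yp
  have e1 := (eq_or_mirror one_ne_zero pm xp ((phi2_comm _ _).trans pq) xm qm).resolve_left hxq'
  have e2 := (eq_or_mirror one_ne_zero qm yq pq ym pm).resolve_left hyp'
  have e (i : Fin 2) : f y i = 2 * f m i - f x i := by
    linear_combination e1 i + e2 i
  rw [Real.sq_sqrt (by norm_num), map_ofNat]
  simp only [phi2, e] at xm ⊢
  linear_combination 4 * xm

theorem sqrt_two_mem_D2 (F : Type*) [Field F] [Algebra ℝ F] : √2 ∈ D2 F := by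
  have h1 : √(1 : ℝ) ∈ D2 F := by simpa using one_mem_D2 F
  have h3 := sqrt_three_mem_D2 F
  have h4 := sqrt_four_mem_D2 F
  have h8 : √8 ∈ D2 F := sqrt_mem_D2_of_mirror h3 h3 h4 (by norm_num) (by norm_num)
  have h11 : √11 ∈ D2 F := sqrt_mem_D2_of_mirror h3 h3 h1 (by norm_num) (by norm_num)
  have h5 : √5 ∈ D2 F := sqrt_mem_D2_of_mirror h4 h4 h11 (by norm_num) (by norm_num)
  exact sqrt_mem_D2_of_mirror h1 h5 h8 (by norm_num) (by norm_num)

/-- For every positive integer `n`, the distance `√n` belongs to `D₂(F)`. -/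
theorem stmt11 (F : Type*) [Field F] [Algebra ℝ F] (n : ℕ) (hn : 0 < n) :
    Real.sqrt n ∈ D2 F := by
  induction n using Nat.strong_induction_on with
  | _ n ih =>
    rcases le_or_gt n 4 with h | h
    · interval_cases n
      · simpa using one_mem_D2 F
      · exact_mod_cast sqrt_two_mem_D2 F
      · exact_mod_cast sqrt_three_mem_D2 F
      · exact_mod_cast sqrt_four_mem_D2 F
    · obtain ⟨a, c, ha, hac, hc, hcn, hn'⟩ :
          ∃ a c : ℕ, 0 < a ∧ a < n ∧ 0 < c ∧ c < n ∧ n + c = 4 * a :=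
        ⟨n / 4 + 1, 4 - n % 4, by lia, by lia, by lia, by lia, by lia⟩
      have hA := ih a hac ha
      have hn1 : (n : ℝ) + c = 4 * a := by exact_mod_cast hn'
      refine sqrt_mem_D2_of_mirror hA hA (ih c hcn hc) (by exact_mod_cast (by lia : 1 < n)) ?_
      linear_combination (c : ℝ) * hn1
end

section
/- Let F be a field that is an algebra over ℝ. If x, y ∈ ℝ² and |x−y|² is a rational number with x ≠ y, then there exists a finite set S_xy with {x,y} ⊆ S_xy ⊆ ℝ² such that every unit-distance preserving map f : S_xy → F² satisfies φ₂(f(x),f(y)) = |x−y|²; in other words, {d > 0 : d² ∈ ℚ} ⊆ D₂(F). -/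
open Filter

/-- The filter on maps `ℝ² → F²` generated by the conditions that single unit distances are
preserved: a property holds eventually iff it is forced by finitely many such conditions. -/
def unitFilter (F : Type*) [Field F] : Filter (EuclideanSpace ℝ (Fin 2) → (Fin 2 → F)) :=
  ⨅ p : {p : EuclideanSpace ℝ (Fin 2) × EuclideanSpace ℝ (Fin 2) // dist p.1 p.2 = 1},
    𝓟 {f | phi2 F (f p.1.1) (f p.1.2) = 1}

/-- Squared distance `s` is preserved by all maps preserving suitable finitely many unit
distances. -/
def IsForced (F : Type*) [Field F] [Algebra ℝ F] (s : ℝ) : Prop :=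
  ∀ x y : EuclideanSpace ℝ (Fin 2), dist x y ^ 2 = s →
    ∀ᶠ f in unitFilter F, phi2 F (f x) (f y) = algebraMap ℝ F s

theorem EuclideanSpace.dist_sq_fin_two (x y : EuclideanSpace ℝ (Fin 2)) :
    dist x y ^ 2 = (x 0 - y 0) ^ 2 + (x 1 - y 1) ^ 2 := by
  rw [EuclideanSpace.dist_eq, Real.sq_sqrt (by positivity)]
  simp [Fin.sum_univ_two, Real.dist_eq, sq_abs]

/-- A triangle with prescribed side lengths exists over a given side. -/
theorem EuclideanSpace.exists_dist_eq_dist_eq (x y : EuclideanSpace ℝ (Fin 2)) {c e : ℝ}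
    (hc : 0 ≤ c) (he : 0 ≤ e) (hxy : 0 < dist x y) (h1 : dist x y ≤ c + e)
    (h2 : |c - e| ≤ dist x y) :
    ∃ z, dist x z = c ∧ dist y z = e := by
  set t := dist x y with ht
  have hts : (x 0 - y 0) ^ 2 + (x 1 - y 1) ^ 2 = t ^ 2 :=
    (EuclideanSpace.dist_sq_fin_two x y).symm
  set α := (t ^ 2 + c ^ 2 - e ^ 2) / (2 * t ^ 2) with hα
  have hα' : α * (2 * t ^ 2) = t ^ 2 + c ^ 2 - e ^ 2 := by
    rw [hα]; field_simp
  have hnn : 0 ≤ c ^ 2 / t ^ 2 - α ^ 2 := by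
    have h3 : c ^ 2 / t ^ 2 - α ^ 2 =
        ((c + e) ^ 2 - t ^ 2) * (t ^ 2 - (c - e) ^ 2) / (4 * t ^ 4) := by
      rw [hα]; field_simp; ring
    rw [h3]
    have h4 : t ^ 2 ≤ (c + e) ^ 2 := by gcongr
    have h5 : (c - e) ^ 2 ≤ t ^ 2 := sq_le_sq.2 (h2.trans (le_abs_self t))
    exact div_nonneg (mul_nonneg (by linarith) (by linarith)) (by positivity)
  obtain ⟨β, hβ⟩ : ∃ β : ℝ, β ^ 2 = c ^ 2 / t ^ 2 - α ^ 2 := ⟨_, Real.sq_sqrt hnn⟩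
  have hβ' : (β ^ 2 + α ^ 2) * t ^ 2 = c ^ 2 := by
    rw [hβ]; field_simp; ring
  refine ⟨!₂[x 0 + α * (y 0 - x 0) - β * (y 1 - x 1), x 1 + α * (y 1 - x 1) + β * (y 0 - x 0)],
    ?_, ?_⟩
  · rw [← sq_eq_sq₀ dist_nonneg hc, EuclideanSpace.dist_sq_fin_two]
    simp
    linear_combination hβ' + (β ^ 2 + α ^ 2) * hts
  · rw [← sq_eq_sq₀ dist_nonneg he, EuclideanSpace.dist_sq_fin_two]
    simp
    linear_combination hβ' - hα' + (β ^ 2 + α ^ 2 - 2 * α + 1) * hts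

/-- Two points with equal distances to two points `p`, `q` with `p - q` non-isotropic either
coincide or are opposite vertices of a rhombus. -/
theorem eq_or_add_eq_add_of_phi2 {F : Type*} [Field F] [NeZero (2 : F)] {x y p q : Fin 2 → F}
    {a b : F} (ha : a ≠ 0) (hpq : phi2 F p q = a) (hxp : phi2 F x p = b) (hxq : phi2 F x q = b)
    (hyp : phi2 F y p = b) (hyq : phi2 F y q = b) :
    x = y ∨ x + y = p + q := by
  have h2 : (2 : F) ≠ 0 := NeZero.ne 2
  simp only [phi2] at *
  have horth : (x 0 - y 0) * (p 0 - q 0) + (x 1 - y 1) * (p 1 - q 1) = 0 := by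
    refine mul_left_cancel₀ h2 ?_
    linear_combination hxq - hxp - hyq + hyp
  have hsum : (x 0 + y 0 - p 0 - q 0) * (p 0 - q 0) + (x 1 + y 1 - p 1 - q 1) * (p 1 - q 1)
      = 0 := by
    refine mul_left_cancel₀ h2 ?_
    linear_combination hxq - hxp + hyq - hyp
  have hdiff : (x 0 - y 0) * (x 0 + y 0 - p 0 - q 0) + (x 1 - y 1) * (x 1 + y 1 - p 1 - q 1)
      = 0 := by
    refine mul_left_cancel₀ h2 ?_
    linear_combination hxp + hxq - hyp - hyq
  set s := (x 0 - y 0) * (p 1 - q 1) - (x 1 - y 1) * (p 0 - q 0) with hs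
  set r := (x 0 + y 0 - p 0 - q 0) * (p 1 - q 1) - (x 1 + y 1 - p 1 - q 1) * (p 0 - q 0) with hr
  have hsr : s * r = 0 := by
    rw [hs, hr]
    linear_combination a * hdiff - (x 0 + y 0 - p 0 - q 0) * (p 0 - q 0) * horth
      - (x 1 + y 1 - p 1 - q 1) * (p 1 - q 1) * horth
      + ((x 0 - y 0) * (x 0 + y 0 - p 0 - q 0) + (x 1 - y 1) * (x 1 + y 1 - p 1 - q 1)) * hpq
  rcases mul_eq_zero.1 hsr with h | h
  · left
    funext i
    refine sub_eq_zero.1 (mul_left_cancel₀ ha ?_)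
    fin_cases i
    · change a * (x 0 - y 0) = a * 0
      linear_combination (p 0 - q 0) * horth + (p 1 - q 1) * h - (x 0 - y 0) * hpq
    · change a * (x 1 - y 1) = a * 0
      linear_combination (p 1 - q 1) * horth - (p 0 - q 0) * h - (x 1 - y 1) * hpq
  · right
    funext i
    refine sub_eq_zero.1 (mul_left_cancel₀ ha ?_)
    fin_cases i
    · change a * (x 0 + y 0 - (p 0 + q 0)) = a * 0
      linear_combination (p 0 - q 0) * hsum + (p 1 - q 1) * h - (x 0 + y 0 - p 0 - q 0) * hpq
    · change a * (x 1 + y 1 - (p 1 + q 1)) = a * 0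
      linear_combination (p 1 - q 1) * hsum - (p 0 - q 0) * h - (x 1 + y 1 - p 1 - q 1) * hpq

theorem phi2_self {F : Type*} [Field F] (x : Fin 2 → F) : phi2 F x x = 0 := by simp [phi2]

theorem phi2_of_add_eq_add {F : Type*} [Field F] {x y p q : Fin 2 → F} {a b : F}
    (hpq : phi2 F p q = a) (hxp : phi2 F x p = b) (hxq : phi2 F x q = b)
    (h : x + y = p + q) : phi2 F x y = 4 * b - a := by
  have h0 := congrFun h 0
  have h1 := congrFun h 1
  simp only [phi2, Pi.add_apply] at *
  rw [eq_sub_of_add_eq' h0, eq_sub_of_add_eq' h1]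
  linear_combination 2 * hxp + 2 * hxq - hpq

theorem phi2_smul_of_eq_add {F : Type*} [Field F] {x y x' y' z : Fin 2 → F} (c : F)
    (hx : x' = z + c • (x - z)) (hy : y' = z + c • (y - z)) :
    phi2 F x' y' = c ^ 2 * phi2 F x y := by
  simp only [hx, hy, phi2, Pi.add_apply, Pi.smul_apply, Pi.sub_apply, smul_eq_mul]
  ring

theorem exists_finite_of_eventually_unitFilter {F : Type*} [Field F]
    {P : (EuclideanSpace ℝ (Fin 2) → (Fin 2 → F)) → Prop} (h : ∀ᶠ f in unitFilter F, P f) :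
    ∃ S : Set (EuclideanSpace ℝ (Fin 2)), S.Finite ∧
      ∀ f : EuclideanSpace ℝ (Fin 2) → (Fin 2 → F),
        (∀ u ∈ S, ∀ v ∈ S, dist u v = 1 → phi2 F (f u) (f v) = 1) → P f := by
  obtain ⟨t, ht, hP⟩ := (hasBasis_iInf_principal_finite _).eventually_iff.1 h
  refine ⟨(fun p => p.1.1) '' t ∪ (fun p => p.1.2) '' t, (ht.image _).union (ht.image _), ?_⟩
  intro f hf
  refine hP ?_
  simp only [Set.mem_iInter]
  intro p hp
  exact hf _ (Or.inl ⟨p, hp, rfl⟩) _ (Or.inr ⟨p, hp, rfl⟩) p.2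

theorem eventually_phi2_eq_one (F : Type*) [Field F] {x y : EuclideanSpace ℝ (Fin 2)} (h : dist x y = 1) :
    ∀ᶠ f in unitFilter F, phi2 F (f x) (f y) = 1 :=
  mem_iInf_of_mem (ι := {p : EuclideanSpace ℝ (Fin 2) × EuclideanSpace ℝ (Fin 2) //
    dist p.1 p.2 = 1}) ⟨(x, y), h⟩ (mem_principal_self _)

section

variable (F : Type*) [Field F] [Algebra ℝ F]

theorem isForced_one : IsForced F 1 := by
  intro x y h
  rw [map_one]
  exact eventually_phi2_eq_one F ((pow_eq_one_iff_of_nonneg dist_nonneg two_ne_zero).1 h)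

variable {F}

theorem IsForced.eventually_add_eq_add {a b : ℝ} (ha : IsForced F a) (hb : IsForced F b)
    (ha0 : a ≠ 0) {x y p q : EuclideanSpace ℝ (Fin 2)} (hpq : dist p q ^ 2 = a)
    (hxp : dist x p ^ 2 = b) (hxq : dist x q ^ 2 = b) (hyp : dist y p ^ 2 = b)
    (hyq : dist y q ^ 2 = b) :
    ∀ᶠ f in unitFilter F, f x = f y ∨ f x + f y = f p + f q ∧
      phi2 F (f x) (f y) = algebraMap ℝ F (4 * b - a) := by
  have : CharZero F := charZero_of_injective_algebraMap (algebraMap ℝ F).injective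
  filter_upwards [ha p q hpq, hb x p hxp, hb x q hxq, hb y p hyp, hb y q hyq]
    with f h1 h2 h3 h4 h5
  refine (eq_or_add_eq_add_of_phi2 (by simpa using ha0) h1 h2 h3 h4 h5).imp_right fun h => ⟨h, ?_⟩
  rw [phi2_of_add_eq_add h1 h2 h3 h]
  simp only [map_sub, map_mul, map_ofNat]

/-- The two-valued step: opposite vertices of a rhombus are mapped to the same point or to
points at the right distance. -/
theorem IsForced.eventually_eq_or {a b : ℝ} (ha : IsForced F a) (hb : IsForced F b)
    (ha0 : 0 < a) {x y : EuclideanSpace ℝ (Fin 2)} (hxy : 0 < dist x y)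
    (h : dist x y ^ 2 = 4 * b - a) :
    ∀ᶠ f in unitFilter F, f x = f y ∨ phi2 F (f x) (f y) = algebraMap ℝ F (4 * b - a) := by
  set t := dist x y with ht
  have hts : (x 0 - y 0) ^ 2 + (x 1 - y 1) ^ 2 = t ^ 2 :=
    (EuclideanSpace.dist_sq_fin_two x y).symm
  obtain ⟨β, hβ⟩ : ∃ β : ℝ, β ^ 2 * (4 * t ^ 2) = a := by
    refine ⟨√(a / (4 * t ^ 2)), ?_⟩
    rw [Real.sq_sqrt (by positivity)]
    field_simp
  refine (ha.eventually_add_eq_add hb ha0.ne' (x := x) (y := y)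
    (p := !₂[(x 0 + y 0) / 2 - β * (y 1 - x 1), (x 1 + y 1) / 2 + β * (y 0 - x 0)])
    (q := !₂[(x 0 + y 0) / 2 + β * (y 1 - x 1), (x 1 + y 1) / 2 - β * (y 0 - x 0)])
    ?_ ?_ ?_ ?_ ?_).mono fun f hf => hf.imp_right And.right
  all_goals
    rw [EuclideanSpace.dist_sq_fin_two]
    simp
  · linear_combination 4 * β ^ 2 * hts + hβ
  all_goals linear_combination (β ^ 2 + 1 / 4) * hts + hβ / 4 + h / 4

theorem eventually_ne_of_dist_sq_eq_three {x y : EuclideanSpace ℝ (Fin 2)}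
    (h : dist x y ^ 2 = 3) : ∀ᶠ f in unitFilter F, f x ≠ f y := by
  have : CharZero F := charZero_of_injective_algebraMap (algebraMap ℝ F).injective
  have key : ∀ {u v : EuclideanSpace ℝ (Fin 2)}, dist u v ^ 2 = 3 →
      ∀ᶠ f in unitFilter F, f u = f v ∨ phi2 F (f u) (f v) = algebraMap ℝ F (4 * 1 - 1) := by
    intro u v huv
    refine (isForced_one F).eventually_eq_or (isForced_one F) one_pos ?_ ?_
    · exact dist_nonneg.lt_of_ne' fun h0 => by norm_num [h0] at huv
    · rw [huv]; norm_num
  have h3 : dist x y = √3 := by rw [← h, Real.sqrt_sq dist_nonneg]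
  have h1 : (1 : ℝ) ≤ √3 := Real.one_le_sqrt.2 (by norm_num)
  obtain ⟨z, hxz, hyz⟩ := EuclideanSpace.exists_dist_eq_dist_eq x y (Real.sqrt_nonneg 3)
    zero_le_one (by rw [h3]; linarith) (by rw [h3]; linarith)
    (by rw [h3, abs_of_nonneg (by linarith)]; linarith)
  filter_upwards [key (u := x) (v := z) (by rw [hxz]; norm_num), eventually_phi2_eq_one F hyz]
    with f hf hf' hxy
  rw [← hxy] at hf'
  rcases hf with hf | hf
  · rw [hf, phi2_self] at hf'
    exact zero_ne_one hf'
  · rw [hf'] at hf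
    have h31 := (algebraMap ℝ F).injective ((map_one _).trans hf)
    norm_num at h31

/-- Opposite vertices of the rhombus formed by two unit triangles are mapped to opposite vertices
of a parallelogram. -/
theorem eventually_add_eq_add_of_unit_rhombus {x y p q : EuclideanSpace ℝ (Fin 2)}
    (hpq : dist p q ^ 2 = 1) (hxp : dist x p ^ 2 = 1) (hxq : dist x q ^ 2 = 1)
    (hyp : dist y p ^ 2 = 1) (hyq : dist y q ^ 2 = 1) (hxy : dist x y ^ 2 = 3) :
    ∀ᶠ f in unitFilter F, f x + f y = f p + f q := by
  filter_upwards [(isForced_one F).eventually_add_eq_add (isForced_one F) one_ne_zero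
    hpq hxp hxq hyp hyq, eventually_ne_of_dist_sq_eq_three hxy] with f h1 h2
  exact (h1.resolve_left h2).1

theorem eventually_add_eq_add_of_unit_step (x w : EuclideanSpace ℝ (Fin 2)) (hw : ‖w‖ = 1) :
    ∀ᶠ f in unitFilter F, f x + f (x + (2 : ℝ) • w) = f (x + w) + f (x + w) := by
  have hw2 : w 0 ^ 2 + w 1 ^ 2 = 1 := by
    have := EuclideanSpace.dist_sq_fin_two w 0
    simpa [hw] using this.symm
  have hs : √3 ^ 2 = (3 : ℝ) := Real.sq_sqrt (by norm_num)
  set p : EuclideanSpace ℝ (Fin 2) :=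
    !₂[x 0 + (w 0 - √3 * w 1) / 2, x 1 + (w 1 + √3 * w 0) / 2] with hp
  set q : EuclideanSpace ℝ (Fin 2) :=
    !₂[x 0 + (3 * w 0 - √3 * w 1) / 2, x 1 + (3 * w 1 + √3 * w 0) / 2] with hq
  have h1 : ∀ᶠ f in unitFilter F, f x + f q = f (x + w) + f p := by
    refine eventually_add_eq_add_of_unit_rhombus ?_ ?_ ?_ ?_ ?_ ?_
    all_goals
      rw [EuclideanSpace.dist_sq_fin_two]
      simp [hp, hq]
    all_goals first
      | linear_combination hw2
      | linear_combination hw2 + (w 0 ^ 2 + w 1 ^ 2) / 4 * hs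
      | linear_combination 3 * hw2 + (w 0 ^ 2 + w 1 ^ 2) / 4 * hs
  have h2 : ∀ᶠ f in unitFilter F, f p + f (x + (2 : ℝ) • w) = f (x + w) + f q := by
    refine eventually_add_eq_add_of_unit_rhombus ?_ ?_ ?_ ?_ ?_ ?_
    all_goals
      rw [EuclideanSpace.dist_sq_fin_two]
      simp [hp, hq]
    all_goals first
      | linear_combination hw2
      | linear_combination hw2 + (w 0 ^ 2 + w 1 ^ 2) / 4 * hs
      | linear_combination 3 * hw2 + (w 0 ^ 2 + w 1 ^ 2) / 4 * hs
  filter_upwards [h1, h2] with f h1 h2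
  linear_combination h1 + h2

theorem eventually_eq_add_natCast_smul (x w : EuclideanSpace ℝ (Fin 2)) (hw : ‖w‖ = 1) (n : ℕ) :
    ∀ᶠ f in unitFilter F, f (x + (n : ℝ) • w) = f x + (n : F) • (f (x + w) - f x) := by
  induction n using Nat.twoStepInduction with
  | zero => simp
  | one => simp
  | more n h0 h1 =>
    filter_upwards [h0, h1, eventually_add_eq_add_of_unit_step (F := F) (x + (n : ℝ) • w) w hw]
      with f h0 h1 h2
    have e1 : x + (n : ℝ) • w + w = x + ((n + 1 : ℕ) : ℝ) • w := by push_cast; module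
    have e2 : x + (n : ℝ) • w + (2 : ℝ) • w = x + ((n + 2 : ℕ) : ℝ) • w := by push_cast; module
    rw [e1, e2, h0, h1] at h2
    rw [eq_sub_of_add_eq' h2]
    push_cast
    module

variable (F)

theorem isForced_div_sq {n k : ℕ} (hn : n ≠ 0) (hk : k ≠ 0) : IsForced F ((n / k : ℝ) ^ 2) := by
  have : CharZero F := charZero_of_injective_algebraMap (algebraMap ℝ F).injective
  intro x y hxy
  have hn0 : (0 : ℝ) < n := by positivity
  have hk1 : (1 : ℝ) ≤ k := by exact_mod_cast Nat.one_le_iff_ne_zero.2 hk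
  have hd : dist x y = n / k := (sq_eq_sq₀ dist_nonneg (by positivity)).1 hxy
  have hle : (n / k : ℝ) ≤ n := div_le_self hn0.le hk1
  obtain ⟨z, hxz, hyz⟩ := EuclideanSpace.exists_dist_eq_dist_eq x y hn0.le hn0.le
    (by rw [hd]; positivity) (by rw [hd]; linarith) (by simp)
  set w := (n : ℝ)⁻¹ • (x - z) with hw
  set w' := (n : ℝ)⁻¹ • (y - z) with hw'
  have hwn : ‖w‖ = 1 := by
    rw [hw, norm_smul, ← dist_eq_norm, hxz]
    simp [hn]
  have hwn' : ‖w'‖ = 1 := by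
    rw [hw', norm_smul, ← dist_eq_norm, hyz]
    simp [hn]
  have hx : z + (n : ℝ) • w = x := by rw [hw, smul_inv_smul₀ hn0.ne']; abel
  have hy : z + (n : ℝ) • w' = y := by rw [hw', smul_inv_smul₀ hn0.ne']; abel
  have hunit : dist (z + (k : ℝ) • w) (z + (k : ℝ) • w') = 1 := by
    rw [dist_add_left, dist_smul₀, hw, hw', dist_smul₀, dist_sub_right, hd]
    simp
    field_simp
  filter_upwards [eventually_eq_add_natCast_smul (F := F) z w hwn n,
    eventually_eq_add_natCast_smul (F := F) z w' hwn' n,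
    eventually_eq_add_natCast_smul (F := F) z w hwn k,
    eventually_eq_add_natCast_smul (F := F) z w' hwn' k,
    eventually_phi2_eq_one F hunit] with f h1 h2 h3 h4 h5
  rw [hx] at h1
  rw [hy] at h2
  rw [phi2_smul_of_eq_add _ h3 h4] at h5
  rw [phi2_smul_of_eq_add _ h1 h2]
  have hkF : (k : F) ≠ 0 := by exact_mod_cast hk
  simp only [map_pow, map_div₀, map_natCast]
  field_simp
  linear_combination h5

theorem isForced_ratCast_sq {r : ℚ} (hr : 0 < r) : IsForced F ((r : ℝ) ^ 2) := by
  have h := isForced_div_sq F (n := r.num.natAbs) (k := r.den)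
    (by simpa using hr.ne') r.den_nz
  have e : ((r.num.natAbs : ℝ) / r.den) = r := by
    have h1 : ((r.num.natAbs : ℤ) : ℚ) / r.den = r := by
      rw [Int.natAbs_of_nonneg (Rat.num_nonneg.2 hr.le), Rat.num_div_den]
    simpa using congrArg (Rat.cast (K := ℝ)) h1
  rwa [e] at h

theorem eventually_ne {x y : EuclideanSpace ℝ (Fin 2)} (hxy : x ≠ y) :
    ∀ᶠ f in unitFilter F, f x ≠ f y := by
  have ht : 0 < dist x y := dist_pos.2 hxy
  obtain ⟨k, hk⟩ := exists_nat_one_div_lt ht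
  obtain ⟨n, hn⟩ := exists_nat_ge (dist x y * (k + 1))
  have hk0 : (0 : ℝ) < k + 1 := by positivity
  have hn0 : n ≠ 0 := by
    rintro rfl
    have := mul_pos ht hk0
    norm_num at hn
    linarith
  have hle : dist x y ≤ n / (k + 1) := (le_div_iff₀ hk0).2 hn
  have hadd : ((n + 1 : ℕ) : ℝ) / (k + 1 : ℕ) = n / (k + 1) + 1 / (k + 1) := by
    push_cast; ring
  have hinv : (0 : ℝ) < 1 / (k + 1) := by positivity
  obtain ⟨z, hxz, hyz⟩ := EuclideanSpace.exists_dist_eq_dist_eq x y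
    (c := (n : ℝ) / (k + 1 : ℕ)) (e := ((n + 1 : ℕ) : ℝ) / (k + 1 : ℕ))
    (by positivity) (by positivity) ht (by rw [hadd]; push_cast; linarith)
    (by
      rw [hadd]
      push_cast
      rw [sub_add_cancel_left, abs_neg, abs_of_pos hinv]
      exact hk.le)
  filter_upwards [isForced_div_sq F hn0 k.succ_ne_zero x z (by rw [hxz]),
    isForced_div_sq F n.succ_ne_zero k.succ_ne_zero y z (by rw [hyz])] with f h1 h2 h
  rw [h, h2] at h1
  have h3 := (algebraMap ℝ F).injective h1
  rw [sq_eq_sq₀ (by positivity) (by positivity)] at h3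
  have h4 : ((n + 1 : ℕ) : ℝ) / (k + 1 : ℕ) = n / (k + 1 : ℕ) := h3
  rw [hadd] at h4
  push_cast at h4
  linarith

theorem isForced_ratCast {q : ℚ} (hq : 0 < q) : IsForced F (q : ℝ) := by
  by_cases hq1 : q = 1
  · simpa [hq1] using isForced_one F
  intro x y hxy
  have hqR : (0 : ℝ) < q := by exact_mod_cast hq
  have hd : 0 < dist x y := dist_nonneg.lt_of_ne' fun h => by 
    simp only [h, ne_eq, OfNat.ofNat_ne_zero, not_false_eq_true, zero_pow] at hxy
    exact hqR.ne hxy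
  have ha0 : 0 < |q - 1| / 2 := by
    have := abs_pos.2 (sub_ne_zero.2 hq1)
    positivity
  have e : (q : ℝ) = 4 * ((((q + 1) / 4 : ℚ) : ℝ)) ^ 2 - (((|q - 1| / 2 : ℚ) : ℝ)) ^ 2 := by
    push_cast
    rw [div_pow |(q : ℝ) - 1|, sq_abs]
    ring
  have ha0' : (0 : ℝ) < (((|q - 1| / 2 : ℚ) : ℝ)) := by exact_mod_cast ha0
  filter_upwards [(isForced_ratCast_sq F ha0).eventually_eq_or
    (isForced_ratCast_sq F (r := (q + 1) / 4) (by positivity)) (pow_pos ha0' 2) hd (hxy.trans e),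
    eventually_ne F (dist_pos.1 hd)] with f h1 h2
  rw [e]
  exact h1.resolve_left h2

theorem exists_finite_phi2_eq (x y : EuclideanSpace ℝ (Fin 2)) (hxy : x ≠ y)
    (hq : ∃ q : ℚ, (q : ℝ) = dist x y ^ 2) :
    ∃ S : Set (EuclideanSpace ℝ (Fin 2)), S.Finite ∧ x ∈ S ∧ y ∈ S ∧
      ∀ f : EuclideanSpace ℝ (Fin 2) → (Fin 2 → F),
        (∀ u ∈ S, ∀ v ∈ S, dist u v = 1 → phi2 F (f u) (f v) = 1) →
        phi2 F (f x) (f y) = algebraMap ℝ F (dist x y ^ 2) := by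
  obtain ⟨q, hq⟩ := hq
  have hq0 : 0 < q := by
    have : (0 : ℝ) < q := hq ▸ pow_pos (dist_pos.2 hxy) 2
    exact_mod_cast this
  obtain ⟨S, hS, h⟩ := exists_finite_of_eventually_unitFilter
    (isForced_ratCast F hq0 x y hq.symm)
  refine ⟨insert x (insert y S), (hS.insert y).insert x, by simp, by simp, fun f hf => ?_⟩
  rw [← hq]
  exact h f fun u hu v hv => hf u (by simp [hu]) v (by simp [hv])

end

/-- If `x, y ∈ ℝ²`, `x ≠ y` and `|x−y|²` is rational, then there is a finite set
`S` with `{x,y} ⊆ S ⊆ ℝ²` such that every unit-distance preserving map `f : S → F²`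
satisfies `φ₂(f(x),f(y)) = |x−y|²`; in other words, `{d > 0 : d² ∈ ℚ} ⊆ D₂(F)`. -/
theorem stmt14 (F : Type*) [Field F] [Algebra ℝ F] (x y : EuclideanSpace ℝ (Fin 2))
    (hxy : x ≠ y) (hq : ∃ q : ℚ, (q : ℝ) = dist x y ^ 2) :
    (∃ S : Set (EuclideanSpace ℝ (Fin 2)), S.Finite ∧ x ∈ S ∧ y ∈ S ∧
      ∀ f : EuclideanSpace ℝ (Fin 2) → (Fin 2 → F),
        (∀ u ∈ S, ∀ v ∈ S, dist u v = 1 → phi2 F (f u) (f v) = 1) →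
        phi2 F (f x) (f y) = algebraMap ℝ F (dist x y ^ 2)) ∧
    {d : ℝ | 0 < d ∧ ∃ q : ℚ, (q : ℝ) = d ^ 2} ⊆ D2 F := by
  refine ⟨exists_finite_phi2_eq F x y hxy hq, ?_⟩
  rintro d ⟨hd, hdq⟩
  refine ⟨hd, ?_⟩
  rintro u v rfl
  exact exists_finite_phi2_eq F u v (dist_pos.1 hd) hdq
end
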